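/- arXiv:2601.18126 — 7 statements merged into one kernel-verified Lean document; each statement's English description precedes it below -/
import Mathlib

section
/- For each of the four Jacobi theta functions θ ∈ {θ00, θ01, θ10, θ11}, the function f(z,τ) = θ(z,τ)/η(τ)³ is annihilated by the modified heat operator: for all z ∈ ℂ and τ ∈ ℍ one has ∂f/∂τ(z,τ) + 6πi·G₂(τ)·f(z,τ) − (1/(4πi))·∂²f/∂z²(z,τ) = 0, where all derivatives are complex partial derivatives. -/
open Complex Filter

noncomputable section

/-- Jacobi theta function θ00(z,τ) = Σ_{n∈ℤ} exp(πin²τ + 2πinz). -/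
def θ00 (z τ : ℂ) : ℂ :=
  ∑' n : ℤ, Complex.exp ((Real.pi : ℂ) * I * n ^ 2 * τ + 2 * (Real.pi : ℂ) * I * n * z)

/-- Jacobi theta function θ01(z,τ) = Σ_{n∈ℤ} (−1)^n exp(πin²τ + 2πinz). -/
def θ01 (z τ : ℂ) : ℂ :=
  ∑' n : ℤ, (-1 : ℂ) ^ n *
    Complex.exp ((Real.pi : ℂ) * I * n ^ 2 * τ + 2 * (Real.pi : ℂ) * I * n * z)

/-- Jacobi theta function θ10(z,τ) = Σ_{n∈ℤ} exp(πi(n+1/2)²τ + (2n+1)πiz). -/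
def θ10 (z τ : ℂ) : ℂ :=
  ∑' n : ℤ, Complex.exp ((Real.pi : ℂ) * I * (n + 1 / 2) ^ 2 * τ +
    (2 * n + 1) * (Real.pi : ℂ) * I * z)

/-- Jacobi theta function θ11(z,τ) = Σ_{n∈ℤ} (−1)^n exp(πi(n+1/2)²τ + (2n+1)πiz). -/
def θ11 (z τ : ℂ) : ℂ :=
  ∑' n : ℤ, (-1 : ℂ) ^ n * Complex.exp ((Real.pi : ℂ) * I * (n + 1 / 2) ^ 2 * τ +
    (2 * n + 1) * (Real.pi : ℂ) * I * z)

/-- Dedekind eta function η(τ) = q^{1/24} ∏_{n≥1} (1 − qⁿ), q = exp(2πiτ). -/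
def η (τ : ℂ) : ℂ :=
  Complex.exp ((Real.pi : ℂ) * I * τ / 12) *
    ∏' n : ℕ, (1 - Complex.exp (2 * (Real.pi : ℂ) * I * τ) ^ (n + 1))

/-- Weight-two quasimodular Eisenstein series G₂(τ) = 1/24 − Σ_{n≥1} σ₁(n) qⁿ. -/
def G₂ (τ : ℂ) : ℂ :=
  1 / 24 - ∑' n : ℕ, (∑ d ∈ (n + 1).divisors, (d : ℂ)) *
    Complex.exp (2 * (Real.pi : ℂ) * I * τ) ^ (n + 1)

lemma eta_eq_aux : η = ModularForm.eta := by
  funext t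
  simp only [η, ModularForm.eta, ModularForm.eta_q_eq_pow]
  congr 1
  simp only [Function.Periodic.qParam]
  congr 1
  push_cast
  ring

lemma G2_aux (τ : ℂ) (hτ : 0 < τ.im) :
    ((Real.pi : ℂ) * I / 12) * EisensteinSeries.E2 ⟨τ, hτ⟩ = 2 * Real.pi * I * G₂ τ := by
  rw [EisensteinSeries.E2_eq_tsum_cexp]
  have h := tsum_pnat_eq_tsum_succ (f := fun n : ℕ =>
    ((ArithmeticFunction.sigma 1 n : ℕ) : ℂ) * Complex.exp (2 * (Real.pi : ℂ) * I * τ) ^ n)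
  simp only [UpperHalfPlane.coe_mk]
  rw [h]
  simp only [G₂, ArithmeticFunction.sigma_one_apply]
  push_cast
  ring

lemma hasDerivAt_eta_aux (τ : ℂ) (hτ : 0 < τ.im) :
    HasDerivAt η (2 * Real.pi * I * G₂ τ * η τ) τ := by
  have hd : DifferentiableAt ℂ η τ := by
    rw [eta_eq_aux]
    exact ModularForm.differentiableAt_eta_of_mem_upperHalfPlaneSet hτ
  have h0 : η τ ≠ 0 := by
    rw [eta_eq_aux]
    exact ModularForm.eta_ne_zero hτ
  have h := ModularForm.logDeriv_eta_eq_E2 ⟨τ, hτ⟩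
  rw [G2_aux, ← eta_eq_aux, logDeriv_apply, div_eq_iff h0] at h
  rw [← h]
  exact hd.hasDerivAt

/-- general theta term -/
def thT (c : ℤ → ℂ) (s : ℝ) (k : ℕ) (n : ℤ) (z τ : ℂ) : ℂ :=
  c n * (n + s) ^ k * Complex.exp ((Real.pi : ℂ) * I * (n + s) ^ 2 * τ +
    2 * (Real.pi : ℂ) * I * (n + s) * z)

/-- bound -/
def thB (k : ℕ) (S T : ℝ) (n : ℤ) : ℝ :=
  Real.exp (2 * Real.pi * S) * (2 ^ (k - 1) * ((|(n : ℝ)| ^ k + 1)) *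
    Real.exp (-Real.pi * (T * n ^ 2 - 2 * (S + T) * |(n : ℝ)|)))

lemma summable_thB (k : ℕ) (S T : ℝ) (hT : 0 < T) : Summable (thB k S T) := by
  have h1 := summable_pow_mul_jacobiTheta₂_term_bound (S + T) hT k
  have h2 := summable_pow_mul_jacobiTheta₂_term_bound (S + T) hT 0
  refine (((h1.add h2).mul_left (2 ^ (k - 1))).mul_left (Real.exp (2 * Real.pi * S))).congr ?_
  intro n
  simp only [thB, Int.cast_abs]
  ring

lemma norm_thT_le (c : ℤ → ℂ) (hc : ∀ n, ‖c n‖ ≤ 1) (s : ℝ) (hs0 : 0 ≤ s) (hs1 : s ≤ 1)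
    (k : ℕ) (n : ℤ) (z τ : ℂ) (S T : ℝ) (hT : 0 < T) (hz : |z.im| ≤ S) (hτ : T ≤ τ.im) :
    ‖thT c s k n z τ‖ ≤ thB k S T n := by
  have hS : 0 ≤ S := (abs_nonneg _).trans hz
  have hpi := Real.pi_pos
  have e1 : ‖Complex.exp ((Real.pi : ℂ) * I * (n + s) ^ 2 * τ +
      2 * (Real.pi : ℂ) * I * (n + s) * z)‖ =
      Real.exp (-Real.pi * (((n : ℝ) + s) ^ 2 * τ.im + 2 * ((n : ℝ) + s) * z.im)) := by
    rw [Complex.norm_exp]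
    congr 1
    rw [show (Real.pi : ℂ) * I * (n + s) ^ 2 * τ + 2 * (Real.pi : ℂ) * I * (n + s) * z =
      ((Real.pi * ((n : ℝ) + s) ^ 2 : ℝ) : ℂ) * τ * I +
      ((2 * Real.pi * ((n : ℝ) + s) : ℝ) : ℂ) * z * I by push_cast; ring,
      add_re, mul_I_re, im_ofReal_mul, mul_I_re, im_ofReal_mul]
    ring
  have e2 : ‖((n : ℂ) + s) ^ k‖ ≤ 2 ^ (k - 1) * (|(n : ℝ)| ^ k + 1) := by
    have : ((n : ℂ) + s) = (((n : ℝ) + s : ℝ) : ℂ) := by push_cast; ring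
    rw [this, norm_pow, Complex.norm_real, Real.norm_eq_abs]
    have h1 : |(n : ℝ) + s| ≤ |(n : ℝ)| + 1 := by
      refine (abs_add_le _ _).trans ?_
      rw [abs_of_nonneg hs0]
      linarith
    refine (pow_le_pow_left₀ (abs_nonneg _) h1 k).trans ?_
    have := add_pow_le (abs_nonneg (n : ℝ)) zero_le_one k
    simpa using this
  have e3 : Real.exp (-Real.pi * (((n : ℝ) + s) ^ 2 * τ.im + 2 * ((n : ℝ) + s) * z.im)) ≤
      Real.exp (2 * Real.pi * S) *
        Real.exp (-Real.pi * (T * n ^ 2 - 2 * (S + T) * |(n : ℝ)|)) := by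
    rw [← Real.exp_add, Real.exp_le_exp]
    have h1 : T * ((n : ℝ) + s) ^ 2 ≤ ((n : ℝ) + s) ^ 2 * τ.im := by
      nlinarith [sq_nonneg ((n : ℝ) + s)]
    have hn : |(n : ℝ) + s| ≤ |(n : ℝ)| + 1 := by
      refine (abs_add_le _ _).trans ?_
      rw [abs_of_nonneg hs0]
      linarith
    have h2 : -(((|(n : ℝ)| + 1)) * S) ≤ ((n : ℝ) + s) * z.im := by
      have : |((n : ℝ) + s) * z.im| ≤ (|(n : ℝ)| + 1) * S := by
        rw [abs_mul]
        exact mul_le_mul hn hz (abs_nonneg _) (by positivity)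
      exact (abs_le.mp this).1
    have h3 : (n : ℝ) ^ 2 - 2 * |(n : ℝ)| ≤ ((n : ℝ) + s) ^ 2 := by
      have h4 : -|(n : ℝ)| ≤ (n : ℝ) * s := by
        have : |(n : ℝ) * s| ≤ |(n : ℝ)| * 1 := by
          rw [abs_mul, abs_of_nonneg hs0]
          exact mul_le_mul_of_nonneg_left hs1 (abs_nonneg _)
        have := (abs_le.mp this).1
        linarith
      nlinarith [sq_nonneg s]
    have h5 := mul_le_mul_of_nonneg_left h3 hT.le
    have h6 : T * n ^ 2 - 2 * (S + T) * |(n : ℝ)| - 2 * S ≤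
        ((n : ℝ) + s) ^ 2 * τ.im + 2 * ((n : ℝ) + s) * z.im := by nlinarith
    have h7 := mul_le_mul_of_nonneg_left h6 hpi.le
    linarith
  rw [thT, norm_mul, norm_mul, e1, thB]
  calc _ ≤ 1 * (2 ^ (k - 1) * (|(n : ℝ)| ^ k + 1)) * (Real.exp (2 * Real.pi * S) *
        Real.exp (-Real.pi * (T * n ^ 2 - 2 * (S + T) * |(n : ℝ)|))) := by
        gcongr
        exact hc n
    _ = _ := by ring

lemma summable_thT (c : ℤ → ℂ) (hc : ∀ n, ‖c n‖ ≤ 1) (s : ℝ) (hs0 : 0 ≤ s) (hs1 : s ≤ 1)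
    (k : ℕ) (z τ : ℂ) (hτ : 0 < τ.im) : Summable fun n => thT c s k n z τ :=
  (summable_thB k |z.im| τ.im hτ).of_norm_bounded
    fun n => norm_thT_le c hc s hs0 hs1 k n z τ _ _ hτ le_rfl le_rfl

lemma hasDerivAt_thT_z (c : ℤ → ℂ) (hc : ∀ n, ‖c n‖ ≤ 1) (s : ℝ) (hs0 : 0 ≤ s) (hs1 : s ≤ 1)
    (k : ℕ) (z τ : ℂ) (hτ : 0 < τ.im) :
    HasDerivAt (fun w => ∑' n, thT c s k n w τ)
      (2 * Real.pi * I * ∑' n, thT c s (k + 1) n z τ) z := by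
  rw [← tsum_mul_left]
  refine hasDerivAt_tsum_of_isPreconnected (t := Metric.ball z 1) (y₀ := z)
    (u := fun n => ‖(2 * Real.pi * I : ℂ)‖ * thB (k + 1) (|z.im| + 1) τ.im n)
    (g' := fun n w => 2 * Real.pi * I * thT c s (k + 1) n w τ)
    ((summable_thB _ _ _ hτ).mul_left _) Metric.isOpen_ball
    (convex_ball z 1).isPreconnected ?_ ?_ (Metric.mem_ball_self one_pos)
    (summable_thT c hc s hs0 hs1 k z τ hτ) (Metric.mem_ball_self one_pos)
  · intro n w _
    have h1 : HasDerivAt (fun w : ℂ => (Real.pi : ℂ) * I * (n + s) ^ 2 * τ +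
        2 * (Real.pi : ℂ) * I * (n + s) * w) (2 * (Real.pi : ℂ) * I * (n + s) * 1) w :=
      ((hasDerivAt_id w).const_mul _).const_add _
    refine (h1.cexp.const_mul (c n * (n + s) ^ k)).congr_deriv ?_
    simp only [thT]
    ring
  · intro n w hw
    rw [norm_mul]
    refine mul_le_mul_of_nonneg_left ?_ (norm_nonneg _)
    refine norm_thT_le c hc s hs0 hs1 _ n w τ _ _ hτ ?_ le_rfl
    rw [Metric.mem_ball, dist_eq_norm] at hw
    have h1 := Complex.abs_im_le_norm (w - z)
    rw [sub_im] at h1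
    have h2 := abs_sub_abs_le_abs_sub w.im z.im
    linarith

lemma hasDerivAt_thT_tau (c : ℤ → ℂ) (hc : ∀ n, ‖c n‖ ≤ 1) (s : ℝ) (hs0 : 0 ≤ s) (hs1 : s ≤ 1)
    (k : ℕ) (z τ : ℂ) (hτ : 0 < τ.im) :
    HasDerivAt (fun t => ∑' n, thT c s k n z t)
      (Real.pi * I * ∑' n, thT c s (k + 2) n z τ) τ := by
  rw [← tsum_mul_left]
  have hr : 0 < τ.im / 2 := by linarith
  refine hasDerivAt_tsum_of_isPreconnected (t := Metric.ball τ (τ.im / 2)) (y₀ := τ)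
    (u := fun n => ‖(Real.pi * I : ℂ)‖ * thB (k + 2) |z.im| (τ.im / 2) n)
    (g' := fun n t => Real.pi * I * thT c s (k + 2) n z t)
    ((summable_thB _ _ _ hr).mul_left _) Metric.isOpen_ball
    (convex_ball τ _).isPreconnected ?_ ?_ (Metric.mem_ball_self hr)
    (summable_thT c hc s hs0 hs1 k z τ hτ) (Metric.mem_ball_self hr)
  · intro n w _
    have h1 : HasDerivAt (fun w : ℂ => (Real.pi : ℂ) * I * (n + s) ^ 2 * w +
        2 * (Real.pi : ℂ) * I * (n + s) * z) ((Real.pi : ℂ) * I * (n + s) ^ 2 * 1) w :=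
      ((hasDerivAt_id w).const_mul _).add_const _
    refine (h1.cexp.const_mul (c n * (n + s) ^ k)).congr_deriv ?_
    simp only [thT]
    ring
  · intro n w hw
    rw [norm_mul]
    refine mul_le_mul_of_nonneg_left ?_ (norm_nonneg _)
    refine norm_thT_le c hc s hs0 hs1 _ n z w _ _ hr le_rfl ?_
    rw [Metric.mem_ball, dist_eq_norm] at hw
    have h1 := Complex.abs_im_le_norm (w - τ)
    rw [sub_im] at h1
    have h2 := (abs_le.mp h1).1
    linarith

lemma theta_rep (θ : ℂ → ℂ → ℂ) (hθ : θ = θ00 ∨ θ = θ01 ∨ θ = θ10 ∨ θ = θ11) :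
    ∃ (c : ℤ → ℂ) (s : ℝ), (∀ n, ‖c n‖ ≤ 1) ∧ 0 ≤ s ∧ s ≤ 1 ∧
      θ = fun z τ => ∑' n, thT c s 0 n z τ := by
  rcases hθ with rfl | rfl | rfl | rfl
  · refine ⟨fun _ => 1, 0, by simp, by simp, by simp, ?_⟩
    funext z τ
    simp [θ00, thT]
  · refine ⟨fun n => (-1) ^ n, 0, by simp, by simp, by simp, ?_⟩
    funext z τ
    simp [θ01, thT]
  · refine ⟨fun _ => 1, 1 / 2, by simp, by norm_num, by norm_num, ?_⟩
    funext z τ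
    refine tsum_congr fun n => ?_
    simp only [thT, pow_zero, one_mul]
    congr 1
    push_cast
    ring
  · refine ⟨fun n => (-1) ^ n, 1 / 2, by simp, by norm_num, by norm_num, ?_⟩
    funext z τ
    refine tsum_congr fun n => ?_
    simp only [thT, pow_zero, mul_one]
    congr 2
    push_cast
    ring

/-- The modified heat operator `∂/∂τ + 6πi·G₂(τ) − (1/(4πi))·∂²/∂z²` annihilates
`θ(z,τ)/η(τ)³` for each of the four Jacobi theta functions. -/
theorem modified_heat_operator_annihilates_theta_div_eta_cubed
    (θ : ℂ → ℂ → ℂ) (hθ : θ = θ00 ∨ θ = θ01 ∨ θ = θ10 ∨ θ = θ11)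
    (z τ : ℂ) (hτ : 0 < τ.im) :
    deriv (fun t : ℂ => θ z t / η t ^ 3) τ
      + 6 * (Real.pi : ℂ) * I * G₂ τ * (θ z τ / η τ ^ 3)
      - 1 / (4 * (Real.pi : ℂ) * I) *
          deriv (deriv (fun w : ℂ => θ w τ / η τ ^ 3)) z = 0 := by
  obtain ⟨c, s, hc, hs0, hs1, rfl⟩ := theta_rep θ hθ
  have h0 : η τ ≠ 0 := by
    rw [eta_eq_aux]
    exact ModularForm.eta_ne_zero hτ
  have hp : (Real.pi : ℂ) ≠ 0 := by exact_mod_cast Real.pi_ne_zero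
  have d1 := (hasDerivAt_thT_tau c hc s hs0 hs1 0 z τ hτ).div
    ((hasDerivAt_eta_aux τ hτ).pow 3) (pow_ne_zero 3 h0)
  have d2 : deriv (fun w : ℂ => (∑' n, thT c s 0 n w τ) / η τ ^ 3) =
      fun w => (2 * Real.pi * I * ∑' n, thT c s 1 n w τ) / η τ ^ 3 := by
    funext w
    exact ((hasDerivAt_thT_z c hc s hs0 hs1 0 w τ hτ).div_const _).deriv
  have d3 := ((hasDerivAt_thT_z c hc s hs0 hs1 1 z τ hτ).const_mul
    (2 * Real.pi * I : ℂ)).div_const (η τ ^ 3)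
  have d1' := d1.deriv
  simp only [Pi.div_def, Pi.pow_apply] at d1'
  simp only [d2]
  rw [d3.deriv, d1']
  simp only [zero_add, Nat.reduceAdd]
  field_simp
  push_cast
  ring_nf
  try simp only [I_sq]
  try ring_nf

end
end

section
/- For every τ ∈ ℍ the Dedekind eta function is complex differentiable and its derivative satisfies η′(τ) = 2πi·G₂(τ)·η(τ); equivalently, the logarithmic derivative of η equals 2πi·G₂. -/
open Complex Filter

noncomputable section

/-- The Dedekind eta function is complex differentiable on the upper half-plane with
`η′(τ) = 2πi·G₂(τ)·η(τ)`, i.e. its logarithmic derivative is `2πi·G₂`. -/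
theorem eta_hasDerivAt (τ : ℂ) (hτ : 0 < τ.im) :
    HasDerivAt η (2 * (Real.pi : ℂ) * I * G₂ τ * η τ) τ := by
  have hη : η = ModularForm.eta := by
    funext z
    simp only [η, ModularForm.eta, ModularForm.eta_q_eq_pow, Function.Periodic.qParam]
    congr 2
    push_cast
    ring
  have hd := (ModularForm.differentiableAt_eta_of_mem_upperHalfPlaneSet
    (z := τ) hτ).hasDerivAt
  have hl := ModularForm.logDeriv_eta_eq_E2 ⟨τ, hτ⟩
  have hne := ModularForm.eta_ne_zero (z := τ) hτ
  have hE : (Real.pi : ℂ) * I / 12 * EisensteinSeries.E2 ⟨τ, hτ⟩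
      = 2 * (Real.pi : ℂ) * I * G₂ τ := by
    have hpi : (Real.pi : ℂ) ≠ 0 := by exact_mod_cast Real.pi_ne_zero
    simp only [EisensteinSeries.E2, Pi.smul_apply, smul_eq_mul]
    rw [EisensteinSeries.G2_eq_tsum_cexp, riemannZeta_two, G₂,
      tsum_pnat_eq_tsum_succ (f := fun n ↦ (ArithmeticFunction.sigma 1 n : ℂ) *
        cexp (2 * Real.pi * I * τ) ^ n)]
    simp only [ArithmeticFunction.sigma_one_apply, Nat.cast_sum]
    field_simp
    ring
  rw [hη]
  have hl' : deriv ModularForm.eta τ / ModularForm.eta τ = 2 * (Real.pi : ℂ) * I * G₂ τ := by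
    rw [← hE, ← hl]
    rfl
  rw [← hl', div_mul_cancel₀ _ hne]
  exact hd

end
end

section
/- The quasimodular Eisenstein series G₂ satisfies G₂(τ+1) = G₂(τ) and the quasimodular transformation law G₂(−1/τ) = τ²·G₂(τ) + τ/(4πi) for every τ ∈ ℍ. -/
open Complex Filter

noncomputable section

lemma G₂_eq_G2 (z : UpperHalfPlane) :
    EisensteinSeries.G2 z = 8 * (Real.pi : ℂ) ^ 2 * G₂ (z : ℂ) := by
  rw [EisensteinSeries.G2_eq_tsum_cexp, riemannZeta_two, G₂,
    tsum_pnat_eq_tsum_succ (f := fun n : ℕ => (ArithmeticFunction.sigma 1 n : ℂ) *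
      Complex.exp (2 * (Real.pi : ℂ) * I * z) ^ n)]
  have : ∀ n : ℕ, (ArithmeticFunction.sigma 1 (n + 1) : ℂ) =
      ∑ d ∈ (n + 1).divisors, (d : ℂ) := by
    intro n
    rw [ArithmeticFunction.sigma_one_apply]
    push_cast
    rfl
  simp only [this]
  ring

/-- The quasimodular transformation laws of G₂: periodicity `G₂(τ+1) = G₂(τ)` and
`G₂(−1/τ) = τ²·G₂(τ) + τ/(4πi)`. -/
theorem G₂_quasimodular (τ : ℂ) (hτ : 0 < τ.im) :
    G₂ (τ + 1) = G₂ τ ∧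
    G₂ (-1 / τ) = τ ^ 2 * G₂ τ + τ / (4 * (Real.pi : ℂ) * I) := by
  constructor
  · have h : Complex.exp (2 * (Real.pi : ℂ) * I * (τ + 1)) =
        Complex.exp (2 * (Real.pi : ℂ) * I * τ) := by
      rw [mul_add, mul_one, Complex.exp_periodic]
    simp only [G₂, h]
  · have h := EisensteinSeries.G2_S_transform ⟨τ, hτ⟩
    have hS : ((ModularGroup.S • (⟨τ, hτ⟩ : UpperHalfPlane) : UpperHalfPlane) : ℂ) = -1 / τ := by
      rw [UpperHalfPlane.modular_S_smul]
      simp [neg_div, inv_neg]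
    rw [G₂_eq_G2, G₂_eq_G2, hS] at h
    have h0 : τ ≠ 0 := by
      rintro rfl
      simp at hτ
    have hpi : (Real.pi : ℂ) ≠ 0 := by exact_mod_cast Real.pi_ne_zero
    have hI : I ≠ 0 := I_ne_zero
    change 8 * (Real.pi : ℂ) ^ 2 * G₂ τ = (τ ^ 2)⁻¹ * _ - -2 * Real.pi * I / τ at h
    generalize G₂ (-1 / τ) = A at *
    generalize G₂ τ = B at *
    field_simp at h ⊢
    have h2 : I * I = -1 := I_mul_I
    linear_combination (-(I / 2)) * h - τ * h2

end
end

section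
/- For all z ∈ ℂ and τ ∈ ℍ, the normalized theta function θ11/η transforms under the modular inversion τ ↦ −1/τ by θ11(z/τ, −1/τ)/η(−1/τ) = −i · exp(πiz²/τ) · θ11(z,τ)/η(τ). -/
open Complex Filter

noncomputable section

lemma θ11_eq_jac (z τ : ℂ) : θ11 z τ =
    Complex.exp ((Real.pi : ℂ) * I * (τ / 4 + z)) * jacobiTheta₂ (z + 1 / 2 + τ / 2) τ := by
  unfold θ11 jacobiTheta₂ jacobiTheta₂_term
  rw [← tsum_mul_left]
  refine tsum_congr fun n => ?_
  rw [← Complex.exp_pi_mul_I, ← Complex.exp_int_mul, ← Complex.exp_add, ← Complex.exp_add]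
  congr 1
  ring

lemma η_eq_eta (τ : ℂ) : η τ = ModularForm.eta τ := by
  unfold η ModularForm.eta
  congr 1
  · unfold Function.Periodic.qParam
    congr 1
    push_cast
    ring
  · exact tprod_congr fun n => by rw [ModularForm.eta_q_eq_pow]

lemma sqrt_aux (τ : ℂ) (hτ : 0 < τ.im) :
    I ^ (1 / 2 : ℂ) * (-I * τ) ^ (1 / 2 : ℂ) = τ ^ (1 / 2 : ℂ) := by
  have h0 : τ ≠ 0 := by rintro rfl; simp at hτ
  have h1 : -I * τ ≠ 0 := by simp [h0]
  have h2 : 0 < (-I * τ).re := by simpa using hτ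
  have h3 := abs_lt.1 (Complex.abs_arg_lt_pi_div_two_iff.2 (Or.inl h2))
  have h4 : I * (-I * τ) = τ := by
    rw [← mul_assoc, mul_neg, I_mul_I]; ring
  have h5 : Complex.log (I * (-I * τ)) = Complex.log I + Complex.log (-I * τ) := by
    apply Complex.log_mul I_ne_zero h1
    rw [Complex.arg_I]
    constructor <;> linarith [Real.pi_pos, h3.1, h3.2]
  rw [h4] at h5
  rw [Complex.cpow_def_of_ne_zero I_ne_zero, Complex.cpow_def_of_ne_zero h1,
    Complex.cpow_def_of_ne_zero h0, ← Complex.exp_add, h5, add_mul]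

lemma η_S (τ : ℂ) (hτ : 0 < τ.im) : η (-1 / τ) = (-I * τ) ^ (1 / 2 : ℂ) * η τ := by
  have h := ModularForm.eta_comp_eq_csqrt_I_inv (show τ ∈ UpperHalfPlane.upperHalfPlaneSet from hτ)
  simp only [Function.comp_apply, Pi.smul_apply, Pi.mul_apply, smul_eq_mul] at h
  have hs : ∀ w : ℂ, Complex.sqrt w = w ^ (1 / 2 : ℂ) := fun w => by simp [Complex.sqrt]
  have hI : I ^ (1 / 2 : ℂ) ≠ 0 := by simp [Complex.cpow_eq_zero_iff]
  rw [η_eq_eta, η_eq_eta, h, hs, hs, ← sqrt_aux τ hτ]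
  field_simp

lemma θ11_S (z τ : ℂ) (hτ : 0 < τ.im) : θ11 (z / τ) (-1 / τ) =
    -I * Complex.exp ((Real.pi : ℂ) * I * z ^ 2 / τ) * ((-I * τ) ^ (1 / 2 : ℂ) * θ11 z τ) := by
  have h0 : τ ≠ 0 := by rintro rfl; simp at hτ
  have hc : (-I * τ) ^ (1 / 2 : ℂ) ≠ 0 := by simp [Complex.cpow_eq_zero_iff, h0]
  have hw := jacobiTheta₂_functional_equation (z + τ / 2 - 1 / 2) τ
  rw [θ11_eq_jac, θ11_eq_jac,
    show z + 1 / 2 + τ / 2 = (z + τ / 2 - 1 / 2) + 1 by ring, jacobiTheta₂_add_left, hw,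
    show z / τ + 1 / 2 + -1 / τ / 2 = (z + τ / 2 - 1 / 2) / τ by field_simp; ring]
  set J := jacobiTheta₂ ((z + τ / 2 - 1 / 2) / τ) (-1 / τ)
  have e1 : -I = Complex.exp (-(Real.pi : ℂ) / 2 * I) := (Complex.exp_neg_pi_div_two_mul_I).symm
  have key : Complex.exp ((Real.pi : ℂ) * I * (-1 / τ / 4 + z / τ)) =
      -I * Complex.exp ((Real.pi : ℂ) * I * z ^ 2 / τ) *
      Complex.exp ((Real.pi : ℂ) * I * (τ / 4 + z)) *
      Complex.exp (-(Real.pi : ℂ) * I * (z + τ / 2 - 1 / 2) ^ 2 / τ) := by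
    rw [e1, ← Complex.exp_add, ← Complex.exp_add, ← Complex.exp_add]
    congr 1
    field_simp
    ring
  rw [key]
  field_simp

/-- Under the modular inversion `τ ↦ −1/τ`:
`θ11(z/τ,−1/τ)/η(−1/τ) = −i·e^{πiz²/τ}·θ11(z,τ)/η(τ)`. -/
theorem θ11_div_eta_S_transform (z τ : ℂ) (hτ : 0 < τ.im) :
    θ11 (z / τ) (-1 / τ) / η (-1 / τ)
      = -I * Complex.exp ((Real.pi : ℂ) * I * z ^ 2 / τ) * (θ11 z τ / η τ) := by
  have h0 : τ ≠ 0 := by rintro rfl; simp at hτ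
  have hc : (-I * τ) ^ (1 / 2 : ℂ) ≠ 0 := by simp [Complex.cpow_eq_zero_iff, h0]
  rw [θ11_S z τ hτ, η_S τ hτ, mul_div_assoc, mul_div_mul_left _ _ hc]

end
end

section
/- For all z ∈ ℂ and τ ∈ ℍ, the degeneration identity q^{−1/12} · θ11(z,τ)/η(τ) = (e^{πiz} − e^{−πiz}) · ∏_{m=1}^∞ (1 − q^m e^{2πiz})(1 − q^m e^{−2πiz}) holds, where q^{−1/12} = exp(−πiτ/6); in particular, as q → 0 the left-hand side tends to e^{πiz} − e^{−πiz}. -/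
open Complex Filter

noncomputable section

/-- Gaussian binomial coefficient. -/
def gB (q : ℂ) : ℕ → ℕ → ℂ
  | _, 0 => 1
  | 0, _ + 1 => 0
  | n + 1, k + 1 => gB q n k + q ^ (k + 1) * gB q n (k + 1)

/-- Finite product. -/
def qP (q : ℂ) (n : ℕ) : ℂ := ∏ j ∈ Finset.range n, (1 - q ^ (j + 1))

lemma gB_zero_right (q : ℂ) (n : ℕ) : gB q n 0 = 1 := by cases n <;> rfl

lemma gB_eq_zero (q : ℂ) (n : ℕ) : ∀ k, n < k → gB q n k = 0 := by
  induction n with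
  | zero => intro k hk; cases k with
    | zero => omega
    | succ k => rfl
  | succ n ih => intro k hk; cases k with
    | zero => omega
    | succ k => rw [gB, ih k (by omega), ih (k + 1) (by omega)]; simp

lemma gB_mul (q : ℂ) (n : ℕ) : ∀ k m, k + m = n → gB q n k * (qP q k * qP q m) = qP q n := by
  induction n with
  | zero =>
    intro k m h
    obtain ⟨rfl, rfl⟩ : k = 0 ∧ m = 0 := by omega
    simp [gB, qP]
  | succ n ih =>
    intro k m h
    cases k with
    | zero => obtain rfl : m = n + 1 := by omega
              simp [gB, qP]
    | succ k =>
      have e1 : ∀ n, qP q (n + 1) = qP q n * (1 - q ^ (n + 1)) := fun n => by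
        simp [qP, Finset.prod_range_succ]
      rw [gB]
      cases m with
      | zero =>
        obtain rfl : k = n := by omega
        have := ih k 0 (by omega)
        rw [gB_eq_zero q k (k + 1) (by omega), e1]
        linear_combination (1 - q ^ (k + 1)) * this
      | succ m =>
        have h1 := ih k (m + 1) (by omega)
        have h2 := ih (k + 1) m (by omega)
        rw [e1 k, e1 m, e1 n]
        rw [e1 m] at h1
        rw [e1 k] at h2
        have : q ^ (n + 1) = q ^ (k + 1) * q ^ (m + 1) := by rw [← pow_add]; congr 1; omega
        rw [this]
        linear_combination (1 - q ^ (k + 1)) * h1 + q ^ (k + 1) * (1 - q ^ (m + 1)) * h2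

lemma qbinom (q : ℂ) (n : ℕ) : ∀ y : ℂ, ∏ j ∈ Finset.range n, (1 + y * q ^ j) =
    ∑ k ∈ Finset.range (n + 1), q ^ (k.choose 2) * gB q n k * y ^ k := by
  induction n with
  | zero => intro y; simp [gB]
  | succ n ih =>
    intro y
    rw [Finset.prod_range_succ']
    have : ∏ k ∈ Finset.range n, (1 + y * q ^ (k + 1)) =
        ∏ k ∈ Finset.range n, (1 + (y * q) * q ^ k) :=
      Finset.prod_congr rfl fun k _ => by ring
    rw [this, ih, Finset.sum_range_succ' _ (n + 1)]
    have e : ∀ k ∈ Finset.range (n + 1), q ^ ((k + 1).choose 2) * gB q (n + 1) (k + 1) * y ^ (k + 1)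
        = q ^ (k.choose 2) * gB q n k * (y * q) ^ k * y
          + q ^ ((k + 1).choose 2) * gB q n (k + 1) * (y * q) ^ (k + 1) := by
      intro k _
      rw [gB, Nat.choose_succ_succ' k 1, Nat.choose_one_right]
      ring
    rw [Finset.sum_congr rfl e, Finset.sum_add_distrib, ← Finset.sum_mul]
    have s2 := Finset.sum_range_succ' (fun k => q ^ (k.choose 2) * gB q n k * (y * q) ^ k) (n + 1)
    rw [Finset.sum_range_succ, gB_eq_zero q n (n + 1) (by omega)] at s2
    simp only [gB_zero_right] at s2 ⊢
    simp at s2 ⊢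
    linear_combination s2

/-- Theta term. -/
def tT (z τ : ℂ) (l : ℤ) : ℂ :=
  (-1 : ℂ) ^ l * cexp ((Real.pi : ℂ) * I * (l * (l + 1)) * τ + 2 * (Real.pi : ℂ) * I * l * z)

lemma finite_triple (z τ : ℂ) (N : ℕ) :
    (∏ j ∈ Finset.range N, (1 - cexp (2 * (Real.pi : ℂ) * I * τ) ^ (j + 1) *
        cexp (2 * (Real.pi : ℂ) * I * z))) *
    (∏ j ∈ Finset.range N, (1 - cexp (2 * (Real.pi : ℂ) * I * τ) ^ j *
        cexp (-(2 : ℂ) * (Real.pi : ℂ) * I * z))) =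
    ∑ k ∈ Finset.range (2 * N + 1), gB (cexp (2 * (Real.pi : ℂ) * I * τ)) (2 * N) k *
      tT z τ ((k : ℤ) - N) := by
  set q := cexp (2 * (Real.pi : ℂ) * I * τ) with hq
  set y := -cexp (2 * (Real.pi : ℂ) * I * (z + (1 - N) * τ)) with hy
  set M : ℂ := (-1) ^ N * cexp (2 * (Real.pi : ℂ) * I * (N * z - N * (N - 1) / 2 * τ)) with hM
  have hM0 : M ≠ 0 := by simp [hM, Complex.exp_ne_zero]
  have hqp : ∀ k : ℕ, q ^ k = cexp (2 * (Real.pi : ℂ) * I * (k * τ)) := by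
    intro k; rw [hq, ← Complex.exp_nat_mul]; congr 1; ring
  have hb := qbinom q (2 * N) y
  have hR : ∀ k ∈ Finset.range (2 * N + 1), q ^ (k.choose 2) * gB q (2 * N) k * y ^ k =
      M * (gB q (2 * N) k * tT z τ ((k : ℤ) - N)) := by
    intro k _
    have : q ^ (k.choose 2) * y ^ k = M * tT z τ ((k : ℤ) - N) := by
      rw [hqp, hy, hM, tT, neg_pow, ← Complex.exp_nat_mul, Nat.cast_choose_two,
        zpow_sub₀ (by norm_num), zpow_natCast, zpow_natCast]
      have h1 : ((-1 : ℂ)) ^ N ≠ 0 := by simp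
      calc _ = (-1) ^ k * (cexp (2 * (Real.pi : ℂ) * I * (((k : ℂ) * (k - 1) / 2) * τ)) *
              cexp (k * (2 * (Real.pi : ℂ) * I * (z + (1 - N) * τ)))) := by ring
        _ = (-1) ^ k * (cexp (2 * (Real.pi : ℂ) * I * (N * z - N * (N - 1) / 2 * τ)) *
              cexp ((Real.pi : ℂ) * I * (((k : ℤ) - (N : ℤ) : ℤ) * (((k : ℤ) - (N : ℤ) : ℤ) + 1)) * τ
              + 2 * (Real.pi : ℂ) * I * ((k : ℤ) - (N : ℤ) : ℤ) * z)) := by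
            rw [← Complex.exp_add, ← Complex.exp_add]
            congr 2
            push_cast
            ring
        _ = _ := by field_simp
    linear_combination gB q (2 * N) k * this
  rw [Finset.sum_congr rfl hR, ← Finset.mul_sum] at hb
  apply mul_left_cancel₀ hM0
  rw [← hb, two_mul N, Finset.prod_range_add]
  have h2 : ∏ x ∈ Finset.range N, (1 + y * q ^ (N + x)) =
      ∏ j ∈ Finset.range N, (1 - q ^ (j + 1) * cexp (2 * (Real.pi : ℂ) * I * z)) := by
    refine Finset.prod_congr rfl fun j _ => ?_
    rw [hqp, hqp, hy, neg_mul, ← Complex.exp_add, ← Complex.exp_add, sub_eq_add_neg]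
    congr 3
    push_cast
    ring
  have h3 : ∏ x ∈ Finset.range N, (1 + y * q ^ x) = M * ∏ j ∈ Finset.range N, (1 - q ^ j *
        cexp (-(2 : ℂ) * (Real.pi : ℂ) * I * z)) := by
    have hMp : M = ∏ j ∈ Finset.range N, (-cexp (2 * (Real.pi : ℂ) * I * (z - j * τ))) := by
      rw [hM, Finset.prod_neg, Finset.card_range, ← Complex.exp_sum]
      congr 2
      have : ∀ n : ℕ, ∑ i ∈ Finset.range n, 2 * (Real.pi : ℂ) * I * (z - i * τ) =
          2 * (Real.pi : ℂ) * I * (n * z - n * (n - 1) / 2 * τ) := by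
        intro n
        induction n with
        | zero => simp
        | succ n ih => rw [Finset.sum_range_succ, ih]; push_cast; ring
      rw [this]
    rw [hMp, ← Finset.prod_mul_distrib, ← Finset.prod_range_reflect]
    refine Finset.prod_congr rfl fun j hj => ?_
    have hj' : j + 1 ≤ N := Finset.mem_range.mp hj
    have hc : ((N - 1 - j : ℕ) : ℂ) = N - 1 - j := by
      rw [Nat.sub_sub, Nat.cast_sub (by omega)]; push_cast; ring
    rw [hqp, hqp, hy, mul_sub, mul_one, neg_mul, neg_mul, ← Complex.exp_add, ← Complex.exp_add,
      ← Complex.exp_add, hc]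
    have e1 : 2 * (Real.pi : ℂ) * I * (z - j * τ) + (2 * (Real.pi : ℂ) * I * (j * τ) +
      -(2 : ℂ) * (Real.pi : ℂ) * I * z) = 0 := by ring
    have e2 : 2 * (Real.pi : ℂ) * I * (z + (1 - N) * τ) + 2 * (Real.pi : ℂ) * I * ((N - 1 - j) * τ)
      = 2 * (Real.pi : ℂ) * I * (z - j * τ) := by ring
    rw [e1, e2, Complex.exp_zero]
    ring
  rw [h2, h3]
  ring

/-- Coefficient. -/
def cc (q : ℂ) (N : ℕ) (l : ℤ) : ℂ := if -(N : ℤ) ≤ l then gB q (2 * N) (l + N).toNat else 0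

lemma sum_eq_tsum (q : ℂ) (T : ℤ → ℂ) (N : ℕ) :
    ∑ k ∈ Finset.range (2 * N + 1), gB q (2 * N) k * T ((k : ℤ) - N) = ∑' l : ℤ, cc q N l * T l := by
  have hinj : Function.Injective (fun k : ℕ => (k : ℤ) - N) := fun a b h => by
    simp only at h; omega
  rw [tsum_eq_sum (s := (Finset.range (2 * N + 1)).map ⟨_, hinj⟩), Finset.sum_map]
  · refine Finset.sum_congr rfl fun k _ => ?_
    simp [cc]
  · intro l hl
    unfold cc
    split_ifs with h
    · rw [gB_eq_zero, zero_mul]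
      by_contra hc
      apply hl
      simp only [Finset.mem_map, Finset.mem_range, Function.Embedding.coeFn_mk]
      exact ⟨(l + N).toNat, by omega, by omega⟩
    · simp

lemma qP_tendsto {q : ℂ} (hq : ‖q‖ < 1) :
    Tendsto (qP q) atTop (nhds (∏' n : ℕ, (1 - q ^ (n + 1)))) :=
  (ModularForm.multipliable_one_sub_pow hq).tendsto_prod_tprod_nat

lemma one_sub_ne {q : ℂ} (hq : ‖q‖ < 1) (n : ℕ) : 1 - q ^ (n + 1) ≠ 0 := by
  rw [sub_ne_zero]
  intro h
  have h1 : ‖q ^ (n + 1)‖ < 1 := by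
    rw [norm_pow]; exact pow_lt_one₀ (norm_nonneg _) hq (by omega)
  rw [← h] at h1
  simp at h1

lemma qP_ne {q : ℂ} (hq : ‖q‖ < 1) (n : ℕ) : qP q n ≠ 0 :=
  Finset.prod_ne_zero_iff.mpr fun i _ => one_sub_ne hq i

lemma qP_lim_ne {q : ℂ} (hq : ‖q‖ < 1) : ∏' n : ℕ, (1 - q ^ (n + 1)) ≠ 0 := by
  have := tprod_one_add_ne_zero_of_summable (f := fun n : ℕ => -q ^ (n + 1))
    (fun i => by simpa [← sub_eq_add_neg] using one_sub_ne hq i)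
    (by simpa using (summable_nat_add_iff 1).mpr (summable_geometric_of_lt_one (norm_nonneg _) hq))
  simpa [← sub_eq_add_neg] using this

lemma gB_eq {q : ℂ} (hq : ‖q‖ < 1) (k m : ℕ) :
    gB q (k + m) k = qP q (k + m) * ((qP q k)⁻¹ * (qP q m)⁻¹) := by
  rw [← gB_mul q (k + m) k m rfl]
  have := qP_ne hq k
  have := qP_ne hq m
  field_simp

lemma cc_eq {q : ℂ} (hq : ‖q‖ < 1) (N : ℕ) (l : ℤ) (h1 : -(N : ℤ) ≤ l) (h2 : l ≤ N) :
    cc q N l = qP q (2 * N) * ((qP q (l + N).toNat)⁻¹ * (qP q (N - l).toNat)⁻¹) := by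
  rw [cc, if_pos h1]
  have : 2 * N = (l + N).toNat + (N - l).toNat := by omega
  rw [this, gB_eq hq]

lemma cc_tendsto {q : ℂ} (hq : ‖q‖ < 1) (l : ℤ) :
    Tendsto (fun N => cc q N l) atTop (nhds (∏' n : ℕ, (1 - q ^ (n + 1)))⁻¹) := by
  have h := qP_tendsto hq
  have h0 := qP_lim_ne hq
  have t1 : Tendsto (fun N : ℕ => 2 * N) atTop atTop :=
    tendsto_atTop_mono (fun N => by simp only [id]; omega) tendsto_id
  have t2 : Tendsto (fun N : ℕ => (l + N).toNat) atTop atTop := by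
    rw [tendsto_atTop]; intro b
    filter_upwards [eventually_ge_atTop (b + l.natAbs)] with N hN
    omega
  have t3 : Tendsto (fun N : ℕ => ((N : ℤ) - l).toNat) atTop atTop := by
    rw [tendsto_atTop]; intro b
    filter_upwards [eventually_ge_atTop (b + l.natAbs)] with N hN
    omega
  have := (h.comp t1).mul (((h.comp t2).inv₀ h0).mul ((h.comp t3).inv₀ h0))
  rw [mul_inv_cancel_left₀ h0] at this
  refine this.congr' ?_
  filter_upwards [eventually_ge_atTop l.natAbs] with N hN
  rw [cc_eq hq N l (by omega) (by omega)]
  rfl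

lemma cc_bound {q : ℂ} (hq : ‖q‖ < 1) : ∃ C : ℝ, 0 ≤ C ∧ ∀ N l, ‖cc q N l‖ ≤ C := by
  have h := qP_tendsto hq
  obtain ⟨A, hA⟩ := h.norm.bddAbove_range
  obtain ⟨B, hB⟩ := (h.inv₀ (qP_lim_ne hq)).norm.bddAbove_range
  have hA' : ∀ n, ‖qP q n‖ ≤ A := fun n => hA ⟨n, rfl⟩
  have hB' : ∀ n, ‖(qP q n)⁻¹‖ ≤ B := fun n => hB ⟨n, rfl⟩
  have hA0 : 0 ≤ A := (norm_nonneg _).trans (hA' 0)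
  have hB0 : 0 ≤ B := (norm_nonneg _).trans (hB' 0)
  refine ⟨A * (B * B), by positivity, fun N l => ?_⟩
  by_cases h1 : -(N : ℤ) ≤ l
  · by_cases h2 : l ≤ N
    · rw [cc_eq hq N l h1 h2, norm_mul, norm_mul]
      gcongr
      · exact hA' _
      · exact hB' _
      · exact hB' _
    · rw [cc, if_pos h1, gB_eq_zero _ _ _ (by omega), norm_zero]; positivity
  · rw [cc, if_neg h1, norm_zero]; positivity

lemma tT_summable (z τ : ℂ) (hτ : 0 < τ.im) : Summable (fun l => ‖tT z τ l‖) := by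
  have h := ((summable_jacobiTheta₂_term_iff (z + τ / 2) τ).mpr hτ).norm
  refine h.congr fun l => ?_
  rw [tT, norm_mul, norm_zpow, norm_neg, norm_one, one_zpow, one_mul, jacobiTheta₂_term]
  congr 2
  ring

lemma triple (z τ : ℂ) (hτ : 0 < τ.im) (hq : ‖cexp (2 * (Real.pi : ℂ) * I * τ)‖ < 1) :
    Tendsto (fun N => (∏ j ∈ Finset.range N, (1 - cexp (2 * (Real.pi : ℂ) * I * τ) ^ (j + 1) *
        cexp (2 * (Real.pi : ℂ) * I * z))) *
    (∏ j ∈ Finset.range N, (1 - cexp (2 * (Real.pi : ℂ) * I * τ) ^ j *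
        cexp (-(2 : ℂ) * (Real.pi : ℂ) * I * z)))) atTop
      (nhds ((∏' n : ℕ, (1 - cexp (2 * (Real.pi : ℂ) * I * τ) ^ (n + 1)))⁻¹ * ∑' l, tT z τ l)) := by
  simp_rw [finite_triple, sum_eq_tsum]
  rw [← tsum_mul_left]
  obtain ⟨C, hC0, hC⟩ := cc_bound hq
  refine tendsto_tsum_of_dominated_convergence (bound := fun l => C * ‖tT z τ l‖)
    ((tT_summable z τ hτ).mul_left C) (fun l => (cc_tendsto hq l).mul_const _) ?_
  refine Eventually.of_forall fun N l => ?_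
  rw [norm_mul]
  gcongr
  exact hC N l

lemma mult_aux {q : ℂ} (hq : ‖q‖ < 1) (x : ℂ) : Multipliable fun n : ℕ => 1 - q ^ (n + 1) * x := by
  have := multipliable_one_add_of_summable (f := fun n : ℕ => -(q ^ (n + 1) * x)) (by
    simpa using ((summable_nat_add_iff 1).mpr
      (summable_geometric_of_lt_one (norm_nonneg _) hq)).mul_right ‖x‖)
  simpa [← sub_eq_add_neg] using this

lemma theta_eq (z τ : ℂ) : θ11 z τ = cexp ((Real.pi : ℂ) * I * τ / 4) *
    cexp ((Real.pi : ℂ) * I * z) * ∑' l, tT z τ l := by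
  rw [θ11, ← tsum_mul_left]
  refine tsum_congr fun l => ?_
  rw [tT, mul_left_comm, ← Complex.exp_add, ← Complex.exp_add]
  congr 2
  ring

lemma degen_main (z τ : ℂ) (hτ : 0 < τ.im) :
      Complex.exp (-(Real.pi : ℂ) * I * τ / 6) * θ11 z τ / η τ
        = (Complex.exp ((Real.pi : ℂ) * I * z) - Complex.exp (-(Real.pi : ℂ) * I * z)) *
          ∏' m : ℕ,
            (1 - Complex.exp (2 * (Real.pi : ℂ) * I * τ) ^ (m + 1) *
                Complex.exp (2 * (Real.pi : ℂ) * I * z)) *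
            (1 - Complex.exp (2 * (Real.pi : ℂ) * I * τ) ^ (m + 1) *
                Complex.exp (-(2 : ℂ) * (Real.pi : ℂ) * I * z)) := by
  have hq : ‖cexp (2 * (Real.pi : ℂ) * I * τ)‖ < 1 :=
    UpperHalfPlane.norm_exp_two_pi_I_lt_one ⟨τ, hτ⟩
  have h1 := triple z τ hτ hq
  rw [(mult_aux hq _).tprod_mul (mult_aux hq _), theta_eq, η]
  have h0 := qP_lim_ne hq
  have hA := (mult_aux hq (cexp (2 * (Real.pi : ℂ) * I * z))).tendsto_prod_tprod_nat
  have hB := (mult_aux hq (cexp (-(2 : ℂ) * (Real.pi : ℂ) * I * z))).tendsto_prod_tprod_nat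
  set q := cexp (2 * (Real.pi : ℂ) * I * τ)
  have hB' : Tendsto (fun N => ∏ j ∈ Finset.range N, (1 - q ^ j *
        cexp (-(2 : ℂ) * (Real.pi : ℂ) * I * z))) atTop
      (nhds ((∏' m : ℕ, (1 - q ^ (m + 1) * cexp (-(2 : ℂ) * (Real.pi : ℂ) * I * z))) *
        (1 - cexp (-(2 : ℂ) * (Real.pi : ℂ) * I * z)))) := by
    rw [← tendsto_add_atTop_iff_nat 1]
    simp_rw [Finset.prod_range_succ']
    simpa using hB.mul_const (1 - cexp (-(2 : ℂ) * (Real.pi : ℂ) * I * z))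
  have key := tendsto_nhds_unique h1 (hA.mul hB')
  rw [inv_mul_eq_iff_eq_mul₀ h0] at key
  rw [key]
  have e1 : cexp (-(Real.pi : ℂ) * I * τ / 6) * cexp ((Real.pi : ℂ) * I * τ / 4) =
      cexp ((Real.pi : ℂ) * I * τ / 12) := by
    rw [← Complex.exp_add]; congr 1; ring
  have e2 : cexp ((Real.pi : ℂ) * I * z) * cexp (-(2 : ℂ) * (Real.pi : ℂ) * I * z) =
      cexp (-(Real.pi : ℂ) * I * z) := by
    rw [← Complex.exp_add]; congr 1; ring
  rw [← e1, ← e2, div_eq_iff (mul_ne_zero (mul_ne_zero (Complex.exp_ne_zero _)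
    (Complex.exp_ne_zero _)) h0)]
  ring

lemma degen_prod_tendsto (x y : ℂ) :
    Tendsto (fun q : ℂ => ∏' m : ℕ, (1 - q ^ (m + 1) * x) * (1 - q ^ (m + 1) * y))
      (nhds 0) (nhds 1) := by
  set K := ‖x‖ + ‖y‖ + ‖x‖ * ‖y‖ with hK
  have hK0 : 0 ≤ K := by positivity
  have hlim : Tendsto (fun q : ℂ => Real.exp (K * (‖q‖ * (1 - ‖q‖)⁻¹)) - 1) (nhds 0) (nhds 0) := by
    have : ContinuousAt (fun q : ℂ => Real.exp (K * (‖q‖ * (1 - ‖q‖)⁻¹)) - 1) 0 := by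
      have : ContinuousAt (fun q : ℂ => (1 - ‖q‖)⁻¹) 0 :=
        ContinuousAt.inv₀ (by fun_prop) (by simp)
      fun_prop
    simpa [ContinuousAt] using this
  rw [tendsto_iff_norm_sub_tendsto_zero]
  refine squeeze_zero' (Eventually.of_forall fun _ => norm_nonneg _) ?_ hlim
  filter_upwards [Metric.ball_mem_nhds (0 : ℂ) one_pos] with q hq
  have hq : ‖q‖ < 1 := by simpa using hq
  have hm := ((mult_aux hq x).mul (mult_aux hq y)).tendsto_prod_tprod_nat
  refine le_of_tendsto (hm.sub_const 1).norm (Eventually.of_forall fun n => ?_)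
  have hb := Finset.norm_prod_one_add_sub_one_le (Finset.range n)
    (fun m : ℕ => (1 - q ^ (m + 1) * x) * (1 - q ^ (m + 1) * y) - 1)
  simp only [add_sub_cancel] at hb
  refine hb.trans ?_
  gcongr
  have hg := summable_geometric_of_lt_one (norm_nonneg q) hq
  calc _ ≤ ∑ m ∈ Finset.range n, K * (‖q‖ * ‖q‖ ^ m) := by
        refine Finset.sum_le_sum fun m _ => ?_
        have e : (1 - q ^ (m + 1) * x) * (1 - q ^ (m + 1) * y) - 1 =
          q ^ (m + 1) * (-x + -y + q ^ (m + 1) * (x * y)) := by ring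
        have h1 : ‖q ^ (m + 1)‖ ≤ 1 := by
          rw [norm_pow]; exact pow_le_one₀ (norm_nonneg _) hq.le
        have h2 : ‖-x + -y + q ^ (m + 1) * (x * y)‖ ≤ K := by
          refine (norm_add₃_le).trans ?_
          rw [norm_neg, norm_neg, norm_mul, norm_mul, hK]
          have : 0 ≤ ‖x‖ * ‖y‖ := by positivity
          nlinarith
        rw [e, norm_mul]
        calc _ ≤ ‖q ^ (m + 1)‖ * K := by gcongr
          _ = _ := by rw [norm_pow]; ring
    _ = K * (‖q‖ * ∑ m ∈ Finset.range n, ‖q‖ ^ m) := by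
        rw [← Finset.mul_sum, ← Finset.mul_sum]
    _ ≤ _ := by
        gcongr
        rw [← tsum_geometric_of_lt_one (norm_nonneg q) hq]
        exact hg.sum_le_tsum _ (fun _ _ => by positivity)

/-- Degeneration identity
`q^{−1/12}·θ11(z,τ)/η(τ) = (e^{πiz} − e^{−πiz})·∏_{m≥1}(1 − qᵐe^{2πiz})(1 − qᵐe^{−2πiz})`,
and as `q → 0` (within the upper half-plane) the left-hand side tends to
`e^{πiz} − e^{−πiz}`. -/
theorem θ11_div_eta_degeneration (z : ℂ) :
    (∀ τ : ℂ, 0 < τ.im →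
      Complex.exp (-(Real.pi : ℂ) * I * τ / 6) * θ11 z τ / η τ
        = (Complex.exp ((Real.pi : ℂ) * I * z) - Complex.exp (-(Real.pi : ℂ) * I * z)) *
          ∏' m : ℕ,
            (1 - Complex.exp (2 * (Real.pi : ℂ) * I * τ) ^ (m + 1) *
                Complex.exp (2 * (Real.pi : ℂ) * I * z)) *
            (1 - Complex.exp (2 * (Real.pi : ℂ) * I * τ) ^ (m + 1) *
                Complex.exp (-(2 : ℂ) * (Real.pi : ℂ) * I * z))) ∧
    Tendsto (fun τ : ℂ => Complex.exp (-(Real.pi : ℂ) * I * τ / 6) * θ11 z τ / η τ)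
      (comap (fun τ : ℂ => Complex.exp (2 * (Real.pi : ℂ) * I * τ)) (nhds 0) ⊓
        Filter.principal {τ : ℂ | 0 < τ.im})
      (nhds (Complex.exp ((Real.pi : ℂ) * I * z) - Complex.exp (-(Real.pi : ℂ) * I * z))) := by
  refine ⟨fun τ hτ => degen_main z τ hτ, ?_⟩
  have h1 : Tendsto (fun τ : ℂ => (Complex.exp ((Real.pi : ℂ) * I * z) -
        Complex.exp (-(Real.pi : ℂ) * I * z)) *
          ∏' m : ℕ,
            (1 - Complex.exp (2 * (Real.pi : ℂ) * I * τ) ^ (m + 1) *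
                Complex.exp (2 * (Real.pi : ℂ) * I * z)) *
            (1 - Complex.exp (2 * (Real.pi : ℂ) * I * τ) ^ (m + 1) *
                Complex.exp (-(2 : ℂ) * (Real.pi : ℂ) * I * z)))
      (comap (fun τ : ℂ => Complex.exp (2 * (Real.pi : ℂ) * I * τ)) (nhds 0) ⊓
        Filter.principal {τ : ℂ | 0 < τ.im})
      (nhds (Complex.exp ((Real.pi : ℂ) * I * z) - Complex.exp (-(Real.pi : ℂ) * I * z))) := by
    have h2 := ((degen_prod_tendsto (Complex.exp (2 * (Real.pi : ℂ) * I * z))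
      (Complex.exp (-(2 : ℂ) * (Real.pi : ℂ) * I * z))).comp
      (tendsto_comap (f := fun τ : ℂ => Complex.exp (2 * (Real.pi : ℂ) * I * τ)))).const_mul
      (Complex.exp ((Real.pi : ℂ) * I * z) - Complex.exp (-(Real.pi : ℂ) * I * z))
    rw [mul_one] at h2
    exact h2.mono_left inf_le_left
  refine h1.congr' ?_
  have : {τ : ℂ | 0 < τ.im} ∈ (comap (fun τ : ℂ => Complex.exp (2 * (Real.pi : ℂ) * I * τ))
      (nhds 0) ⊓ Filter.principal {τ : ℂ | 0 < τ.im}) :=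
    mem_inf_of_right (mem_principal_self _)
  filter_upwards [this] with τ hτ
  exact (degen_main z τ hτ).symm

end
end

section
/- Product expansion of θ00 (Jacobi triple product): for all z ∈ ℂ and τ ∈ ℍ, Σ_{n∈ℤ} exp(πin²τ + 2πinz) = ∏_{n=1}^∞ (1 − q^n)(1 + q^{n−1/2} e^{2πiz})(1 + q^{n−1/2} e^{−2πiz}), where q^{n−1/2} = exp(2πi(n−1/2)τ), and the infinite product converges. -/
open Complex Filter

noncomputable section

def JQ (q : ℂ) (n : ℕ) : ℂ := ∏ i ∈ Finset.range n, (1 - q ^ (i + 1))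

def JD (q : ℂ) (n : ℤ) : ℂ := if 0 ≤ n then (JQ q n.toNat)⁻¹ else 0

lemma J_ne {q : ℂ} (hq : ‖q‖ < 1) (i : ℕ) : 1 - q ^ (i + 1) ≠ 0 := by
  intro h
  have h1 : q ^ (i + 1) = 1 := (sub_eq_zero.mp h).symm
  have h2 : ‖q‖ ^ (i + 1) = 1 := by rw [← norm_pow, h1, norm_one]
  have h3 : ‖q‖ ^ (i + 1) < 1 := pow_lt_one₀ (norm_nonneg _) hq (Nat.succ_ne_zero i)
  linarith

lemma JD_nat (q : ℂ) (n : ℕ) : JD q n = (JQ q n)⁻¹ := by simp [JD]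

lemma JD_rec {q : ℂ} (hq : ‖q‖ < 1) (n : ℤ) : JD q (n - 1) = (1 - q ^ n) * JD q n := by
  rcases lt_trichotomy n 0 with h | h | h
  · rw [JD, JD, if_neg (by omega), if_neg (by omega), mul_zero]
  · subst h
    simp [JD]
  · obtain ⟨m, rfl⟩ : ∃ m : ℕ, n = ((m + 1 : ℕ) : ℤ) := ⟨(n - 1).toNat, by omega⟩
    have : (((m + 1 : ℕ) : ℤ) - 1) = (m : ℤ) := by push_cast; ring
    rw [this, JD_nat, JD_nat, JQ, JQ, Finset.prod_range_succ, mul_inv, zpow_natCast]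
    have := J_ne hq m
    field_simp

def JP (x w : ℂ) (N : ℕ) : ℂ :=
  ∏ n ∈ Finset.range N, ((1 + x ^ (2 * n + 1) * w) * (1 + x ^ (2 * n + 1) * w⁻¹))

lemma J_fin {x w : ℂ} (hx : x ≠ 0) (hw : w ≠ 0) (hx1 : ‖x ^ 2‖ < 1) (N : ℕ) :
    HasSum (fun k : ℤ => JQ (x ^ 2) (2 * N) * (x ^ (k ^ 2) * w ^ k) *
      (JD (x ^ 2) (N - k) * JD (x ^ 2) (N + k))) (JP x w N) := by
  induction N with
  | zero =>
    have : JP x w 0 = (fun k : ℤ => JQ (x ^ 2) (2 * 0) * (x ^ (k ^ 2) * w ^ k) *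
      (JD (x ^ 2) ((0 : ℕ) - k) * JD (x ^ 2) ((0 : ℕ) + k))) 0 := by
      simp [JP, JQ, JD]
    rw [this]
    apply hasSum_single
    intro k hk
    rcases lt_or_gt_of_ne hk with h | h
    · rw [JD, JD, if_neg (show ¬ (0 ≤ ((0 : ℕ) : ℤ) + k) by omega)]; simp
    · rw [JD, if_neg (show ¬ (0 ≤ ((0 : ℕ) : ℤ) - k) by omega)]; simp
  | succ N ih =>
    have h1 := (Equiv.subRight (1 : ℤ)).hasSum_iff.mpr ih
    have h2 := (Equiv.addRight (1 : ℤ)).hasSum_iff.mpr ih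
    have h := ((ih.mul_left (1 + x ^ (2 * N + 1) * x ^ (2 * N + 1))).add
      (h1.mul_left (x ^ (2 * N + 1) * w))).add (h2.mul_left (x ^ (2 * N + 1) * w⁻¹))
    have hv : JP x w (N + 1) = (1 + x ^ (2 * N + 1) * x ^ (2 * N + 1)) * JP x w N +
        x ^ (2 * N + 1) * w * JP x w N + x ^ (2 * N + 1) * w⁻¹ * JP x w N := by
      have e : JP x w (N + 1) = JP x w N *
          ((1 + x ^ (2 * N + 1) * w) * (1 + x ^ (2 * N + 1) * w⁻¹)) :=
        Finset.prod_range_succ _ _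
      have : w * w⁻¹ = 1 := mul_inv_cancel₀ hw
      rw [e]
      linear_combination (JP x w N * x ^ (2 * N + 1) * x ^ (2 * N + 1)) * this
    rw [hv]
    refine Eq.subst (motive := fun f => HasSum f _) (funext fun k => ?_) h
    · symm
      simp only [Function.comp, Equiv.subRight_apply, Equiv.coe_addRight]
      have ea : ((N + 1 : ℕ) : ℤ) - k = (N - k + 1 : ℤ) := by push_cast; ring
      have eb : ((N + 1 : ℕ) : ℤ) + k = (N + k + 1 : ℤ) := by push_cast; ring
      have ec : (N : ℤ) - (k - 1) = (N - k + 1 : ℤ) := by ring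
      have ed : (N : ℤ) + (k - 1) = (N + k - 1 : ℤ) := by ring
      have ee : (N : ℤ) - (k + 1) = (N - k - 1 : ℤ) := by ring
      have ef : (N : ℤ) + (k + 1) = (N + k + 1 : ℤ) := by ring
      rw [ea, eb, ec, ed, ee, ef]
      have hq0 : x ^ 2 ≠ 0 := pow_ne_zero _ hx
      have ra := JD_rec hx1 (N - k + 1)
      have rb := JD_rec hx1 (N + k + 1)
      rw [add_sub_cancel_right, zpow_add_one₀ hq0] at ra rb
      rw [JD_rec hx1 (N - k), JD_rec hx1 (N + k), ra, rb]
      have hQ : JQ (x ^ 2) (2 * (N + 1)) = JQ (x ^ 2) (2 * N) *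
          (1 - x ^ 2 * ((x ^ 2) ^ ((N : ℤ) - k) * (x ^ 2) ^ ((N : ℤ) + k))) *
          (1 - x ^ 2 * x ^ 2 * ((x ^ 2) ^ ((N : ℤ) - k) * (x ^ 2) ^ ((N : ℤ) + k))) := by
        rw [← zpow_add₀ hq0, show (N : ℤ) - k + (N + k) = ((2 * N : ℕ) : ℤ) by push_cast; ring,
          zpow_natCast, show 2 * (N + 1) = 2 * N + 1 + 1 by ring, JQ, JQ,
          Finset.prod_range_succ, Finset.prod_range_succ]
        ring
      have hX : x ^ (2 * N + 1) * x ^ (2 * N + 1) =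
          x ^ 2 * ((x ^ 2) ^ ((N : ℤ) - k) * (x ^ 2) ^ ((N : ℤ) + k)) := by
        rw [← zpow_add₀ hq0, show (N : ℤ) - k + (N + k) = ((2 * N : ℕ) : ℤ) by push_cast; ring,
          zpow_natCast]
        ring
      have h3 : x ^ (2 * N + 1) * w * (x ^ ((k - 1) ^ 2) * w ^ (k - 1)) =
          x ^ (k ^ 2) * w ^ k * (x ^ 2 * (x ^ 2) ^ ((N : ℤ) - k)) := by
        have e1 : w ^ k = w ^ (k - 1) * w := by rw [← zpow_add_one₀ hw]; simp
        have e2 : x ^ (2 * N + 1) * x ^ ((k - 1) ^ 2) =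
            x ^ (k ^ 2) * (x ^ 2 * (x ^ 2) ^ ((N : ℤ) - k)) := by
          rw [← zpow_natCast x 2, ← zpow_natCast x (2 * N + 1), ← zpow_mul, ← zpow_add₀ hx,
            ← zpow_add₀ hx, ← zpow_add₀ hx]
          congr 1; push_cast; ring
        rw [e1]; linear_combination (w * w ^ (k - 1)) * e2
      have h4 : x ^ (2 * N + 1) * w⁻¹ * (x ^ ((k + 1) ^ 2) * w ^ (k + 1)) =
          x ^ (k ^ 2) * w ^ k * (x ^ 2 * (x ^ 2) ^ ((N : ℤ) + k)) := by
        have e1 : w⁻¹ * w ^ (k + 1) = w ^ k := by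
          rw [zpow_add_one₀ hw]; field_simp
        have e2 : x ^ (2 * N + 1) * x ^ ((k + 1) ^ 2) =
            x ^ (k ^ 2) * (x ^ 2 * (x ^ 2) ^ ((N : ℤ) + k)) := by
          rw [← zpow_natCast x 2, ← zpow_natCast x (2 * N + 1), ← zpow_mul, ← zpow_add₀ hx,
            ← zpow_add₀ hx, ← zpow_add₀ hx]
          congr 1; push_cast; ring
        rw [← e1]; linear_combination (w⁻¹ * w ^ (k + 1)) * e2
      rw [hQ, hX]
      clear hQ hX ra rb h h1 h2 ih hv
      generalize JD (x ^ 2) (N - k + 1) = a at *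
      generalize JD (x ^ 2) (N + k + 1) = b at *
      generalize (x ^ 2) ^ ((N : ℤ) - k) = A at *
      generalize (x ^ 2) ^ ((N : ℤ) + k) = B at *
      generalize JQ (x ^ 2) (2 * N) = Q at *
      generalize x ^ (2 * N + 1) = X at *
      generalize x ^ ((k - 1) ^ 2) = u1 at *
      generalize x ^ ((k + 1) ^ 2) = u2 at *
      generalize x ^ (k ^ 2) = u at *
      generalize w ^ (k - 1) = v1 at *
      generalize w ^ (k + 1) = v2 at *
      generalize w ^ k = v at *
      linear_combination (-Q * a * ((1 - B) * ((1 - B * x ^ 2) * b))) * h3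
        - (Q * b * ((1 - A) * ((1 - A * x ^ 2) * a))) * h4

open Topology in
lemma J_main {x w : ℂ} (hx : x ≠ 0) (hw : w ≠ 0) (hx1 : ‖x‖ < 1)
    (hs : Summable fun k : ℤ => ‖x ^ (k ^ 2) * w ^ k‖) :
    Multipliable (fun n : ℕ => (1 - (x ^ 2) ^ (n + 1)) * (1 + x ^ (2 * n + 1) * w) *
      (1 + x ^ (2 * n + 1) * w⁻¹)) ∧
    ∑' k : ℤ, x ^ (k ^ 2) * w ^ k = ∏' n : ℕ, (1 - (x ^ 2) ^ (n + 1)) *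
      (1 + x ^ (2 * n + 1) * w) * (1 + x ^ (2 * n + 1) * w⁻¹) := by
  have hq : ‖x ^ 2‖ < 1 := by
    rw [norm_pow]; exact pow_lt_one₀ (norm_nonneg _) hx1 two_ne_zero
  have sq : Summable fun n : ℕ => ‖-(x ^ 2) ^ (n + 1)‖ := by
    have : (fun n : ℕ => ‖-(x ^ 2) ^ (n + 1)‖) = fun n : ℕ => ‖x ^ 2‖ ^ n * ‖x ^ 2‖ := by
      funext n
      rw [norm_neg, norm_pow (x ^ 2), pow_succ ‖x ^ 2‖]
    rw [this]
    exact (summable_geometric_of_lt_one (norm_nonneg _) hq).mul_right _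
  have sw : ∀ v : ℂ, Summable fun n : ℕ => ‖x ^ (2 * n + 1) * v‖ := by
    intro v
    have : (fun n : ℕ => ‖x ^ (2 * n + 1) * v‖) = fun n : ℕ => ‖x ^ 2‖ ^ n * ‖x * v‖ := by
      funext n
      rw [← norm_pow, ← norm_mul]; congr 1; ring
    rw [this]
    exact (summable_geometric_of_lt_one (norm_nonneg _) hq).mul_right _
  have mq := multipliable_one_add_of_summable sq
  have mt := (mq.mul (multipliable_one_add_of_summable (sw w))).mul
    (multipliable_one_add_of_summable (sw w⁻¹))
  have hne := tprod_one_add_ne_zero_of_summable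
    (fun n => by rw [← sub_eq_add_neg]; exact J_ne hq n) sq
  have tq := mq.tendsto_prod_tprod_nat
  simp only [← sub_eq_add_neg] at mt tq hne
  refine ⟨mt, ?_⟩
  set E := ∏' n : ℕ, (1 - (x ^ 2) ^ (n + 1)) with hE
  replace tq : Tendsto (JQ (x ^ 2)) atTop (𝓝 E) := tq
  have ti := tq.inv₀ hne
  obtain ⟨C, hC⟩ := tq.norm.bddAbove_range
  obtain ⟨C', hC'⟩ := ti.norm.bddAbove_range
  have bQ : ∀ n, ‖JQ (x ^ 2) n‖ ≤ C := fun n => hC ⟨n, rfl⟩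
  have bD : ∀ n, ‖JD (x ^ 2) n‖ ≤ C' := by
    intro n
    rw [JD]
    split_ifs
    · exact hC' ⟨_, rfl⟩
    · rw [norm_zero]; exact (norm_nonneg _).trans (hC' ⟨0, rfl⟩)
  have tD : ∀ k : ℤ, Tendsto (fun N : ℕ => JD (x ^ 2) (N + k)) atTop (𝓝 E⁻¹) := by
    intro k
    have t1 : Tendsto (fun N : ℕ => ((N : ℤ) + k).toNat) atTop atTop := by
      apply tendsto_atTop.mpr
      intro b
      filter_upwards [eventually_ge_atTop (b + k.natAbs)] with N hN
      omega
    refine (ti.comp t1).congr' ?_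
    filter_upwards [eventually_ge_atTop k.natAbs] with N hN
    rw [JD, if_pos (by omega)]; rfl
  have key := tendsto_tsum_of_dominated_convergence (𝓕 := atTop)
    (f := fun (N : ℕ) (k : ℤ) => JQ (x ^ 2) N * (JQ (x ^ 2) (2 * N) * (x ^ (k ^ 2) * w ^ k) *
      (JD (x ^ 2) (N - k) * JD (x ^ 2) (N + k))))
    (g := fun k : ℤ => x ^ (k ^ 2) * w ^ k)
    (hs.mul_left (C * C * (C' * C'))) ?_ ?_
  · have t2 := mt.tendsto_prod_tprod_nat
    refine tendsto_nhds_unique (key.congr ?_) t2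
    intro N
    rw [((J_fin hx hw hq N).mul_left (JQ (x ^ 2) N)).tsum_eq, JQ, JP, ← Finset.prod_mul_distrib]
    simp only [mul_assoc]
  · intro k
    have t2 : Tendsto (fun N : ℕ => JQ (x ^ 2) (2 * N)) atTop (𝓝 E) :=
      tq.comp (tendsto_id.const_mul_atTop' two_pos)
    have t3 : Tendsto (fun N : ℕ => JD (x ^ 2) (N - k)) atTop (𝓝 E⁻¹) := by
      simpa only [← sub_eq_add_neg] using tD (-k)
    have := tq.mul ((t2.mul_const (x ^ (k ^ 2) * w ^ k)).mul (t3.mul (tD k)))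
    convert this using 2
    field_simp
  · refine Eventually.of_forall fun N k => ?_
    have e : JQ (x ^ 2) N * (JQ (x ^ 2) (2 * N) * (x ^ (k ^ 2) * w ^ k) *
      (JD (x ^ 2) (N - k) * JD (x ^ 2) (N + k))) = JQ (x ^ 2) N * JQ (x ^ 2) (2 * N) *
      (JD (x ^ 2) (N - k) * JD (x ^ 2) (N + k)) * (x ^ (k ^ 2) * w ^ k) := by ring
    have C0 : 0 ≤ C := (norm_nonneg _).trans (bQ 0)
    have C0' : 0 ≤ C' := (norm_nonneg _).trans (bD 0)
    rw [e, norm_mul, norm_mul, norm_mul, norm_mul (JD _ _)]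
    gcongr <;> first | exact bQ _ | exact bD _

/-- Product expansion of θ00 (Jacobi triple product):
`Σ_{n∈ℤ} exp(πin²τ + 2πinz)
  = ∏_{n≥1}(1−qⁿ)(1+q^{n−1/2}e^{2πiz})(1+q^{n−1/2}e^{−2πiz})`,
where `q^{n−1/2} = exp(2πi(n−1/2)τ)`, with the infinite product convergent. -/
theorem θ00_product_expansion (z τ : ℂ) (hτ : 0 < τ.im) :
    Multipliable (fun n : ℕ =>
      (1 - Complex.exp (2 * (Real.pi : ℂ) * I * τ) ^ (n + 1)) *
      (1 + Complex.exp (2 * (Real.pi : ℂ) * I * ((n : ℂ) + 1 / 2) * τ) *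
          Complex.exp (2 * (Real.pi : ℂ) * I * z)) *
      (1 + Complex.exp (2 * (Real.pi : ℂ) * I * ((n : ℂ) + 1 / 2) * τ) *
          Complex.exp (-(2 : ℂ) * (Real.pi : ℂ) * I * z))) ∧
    (∑' n : ℤ, Complex.exp ((Real.pi : ℂ) * I * n ^ 2 * τ + 2 * (Real.pi : ℂ) * I * n * z))
      = ∏' n : ℕ,
          (1 - Complex.exp (2 * (Real.pi : ℂ) * I * τ) ^ (n + 1)) *
          (1 + Complex.exp (2 * (Real.pi : ℂ) * I * ((n : ℂ) + 1 / 2) * τ) *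
              Complex.exp (2 * (Real.pi : ℂ) * I * z)) *
          (1 + Complex.exp (2 * (Real.pi : ℂ) * I * ((n : ℂ) + 1 / 2) * τ) *
              Complex.exp (-(2 : ℂ) * (Real.pi : ℂ) * I * z)) := by
  have hT : ∀ k : ℤ, cexp ((Real.pi : ℂ) * I * k ^ 2 * τ + 2 * (Real.pi : ℂ) * I * k * z) =
      cexp (Real.pi * I * τ) ^ (k ^ 2) * cexp (2 * Real.pi * I * z) ^ k := by
    intro k
    rw [← Complex.exp_int_mul, ← Complex.exp_int_mul, ← Complex.exp_add]
    congr 1; push_cast; ring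
  have hq : cexp (2 * Real.pi * I * τ) = cexp (Real.pi * I * τ) ^ 2 := by
    rw [← Complex.exp_nat_mul]; congr 1; push_cast; ring
  have hp : ∀ n : ℕ, cexp (2 * (Real.pi : ℂ) * I * ((n : ℂ) + 1 / 2) * τ) =
      cexp (Real.pi * I * τ) ^ (2 * n + 1) := by
    intro n
    rw [← Complex.exp_nat_mul]; congr 1; push_cast; ring
  have hw : cexp (-(2 : ℂ) * (Real.pi : ℂ) * I * z) = (cexp (2 * Real.pi * I * z))⁻¹ := by
    rw [← Complex.exp_neg]; congr 1; ring
  have hs := ((summable_jacobiTheta₂_term_iff z τ).mpr hτ).norm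
  have hs' : Summable fun k : ℤ =>
      ‖cexp (Real.pi * I * τ) ^ (k ^ 2) * cexp (2 * Real.pi * I * z) ^ k‖ := by
    refine hs.congr fun k => ?_
    rw [← hT, jacobiTheta₂_term, add_comm]
  simp only [hT, hq, hp, hw]
  refine J_main (Complex.exp_ne_zero _) (Complex.exp_ne_zero _) ?_ hs'
  rw [Complex.norm_exp, Real.exp_lt_one_iff]
  simp
  positivity

end
end

section
/- Jacobi derivative formula in this normalization: for every τ ∈ ℍ, the partial derivative of θ11 in z at z = 0 satisfies ∂θ11/∂z(0,τ) = 2πi·η(τ)³. -/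
open Complex Filter

noncomputable section

def jP (q : ℂ) (N : ℕ) : ℂ := ∏ k ∈ Finset.range N, (1 - q ^ (k + 1))

def ju (q : ℂ) (m : ℤ) : ℂ := if m < 0 then 0 else (jP q m.toNat)⁻¹

lemma j_one_sub_ne {q : ℂ} (hq : ‖q‖ < 1) (k : ℕ) : 1 - q ^ (k + 1) ≠ 0 := by
  intro h
  have h1 : q ^ (k + 1) = 1 := (sub_eq_zero.mp h).symm
  have h2 : ‖q‖ ^ (k + 1) < 1 := pow_lt_one₀ (norm_nonneg _) hq (by omega)
  rw [← norm_pow, h1] at h2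
  simp at h2

lemma jP_ne {q : ℂ} (hq : ‖q‖ < 1) (N : ℕ) : jP q N ≠ 0 :=
  Finset.prod_ne_zero_iff.mpr fun k _ => j_one_sub_ne hq k

lemma ju_rec {q : ℂ} (hq : ‖q‖ < 1) (m : ℤ) : ju q (m - 1) = (1 - q ^ m) * ju q m := by
  rcases lt_trichotomy m 0 with h | h | h
  · have h' : m - 1 < 0 := by omega
    simp [ju, h, h']
  · subst h
    simp [ju]
  · obtain ⟨k, rfl⟩ : ∃ k : ℕ, m = (k : ℤ) + 1 := ⟨(m - 1).toNat, by omega⟩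
    have h1 : ¬ ((k : ℤ) < 0) := by omega
    have h2 : ¬ ((k : ℤ) + 1 < 0) := by omega
    have h3 : ((k : ℤ) + 1).toNat = k + 1 := by omega
    have h4 : q ^ ((k : ℤ) + 1) = q ^ (k + 1) := by exact_mod_cast zpow_natCast q (k + 1)
    have := j_one_sub_ne hq k
    have := jP_ne hq k
    simp only [ju, add_sub_cancel_right, h1, h2, if_false, h3, Int.toNat_natCast, h4]
    rw [show jP q (k + 1) = jP q k * (1 - q ^ (k + 1)) from Finset.prod_range_succ _ _]
    field_simp

lemma j_congr {f g : ℤ → ℂ} {a b : ℂ} (h : HasSum f a) (hfg : ∀ n, g n = f n) (hab : b = a) :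
    HasSum g b := by
  rw [show g = f from funext hfg, hab]
  exact h

set_option maxHeartbeats 2000000 in
lemma j_sum {q : ℂ} (hq : ‖q‖ < 1) (hq0 : q ≠ 0) (T : ℤ → ℂ)
    (hT0 : T 0 = 1) (hT : ∀ n, T (n + 1) = - T n * q ^ (n + 1)) (N : ℕ) :
    ∃ s, HasSum (fun n : ℤ => T n * jP q (2 * N + 1) * ju q (N - n) * ju q (N + 1 + n)) s ∧
     HasSum (fun n : ℤ => (2 * n + 1) * (T n * jP q (2 * N + 1) * ju q (N - n) * ju q (N + 1 + n)))
      (2 * jP q N ^ 2) := by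
  induction N with
  | zero =>
    have hTm : T (-1) = -1 := by
      have := hT (-1)
      simp [hT0] at this
      linear_combination this
    have h1q := j_one_sub_ne hq 0
    simp only [zero_add, pow_one] at h1q
    have hz : ∀ n : ℤ, n ∉ ({0, -1} : Finset ℤ) →
        T n * jP q (2 * 0 + 1) * ju q ((0 : ℕ) - n) * ju q ((0 : ℕ) + 1 + n) = 0 := by
      intro n hn
      simp only [Finset.mem_insert, Finset.mem_singleton, not_or] at hn
      rcases lt_or_gt_of_ne hn.1 with h | h
      · have : ((0 : ℕ) : ℤ) + 1 + n < 0 := by omega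
        simp only [ju, this, if_true, mul_zero]
      · have : ((0 : ℕ) : ℤ) - n < 0 := by omega
        simp only [ju, this, if_true, mul_zero, zero_mul]
    refine ⟨_, hasSum_sum_of_ne_finset_zero (s := {0, -1}) hz, ?_⟩
    have hz2 : ∀ n : ℤ, n ∉ ({0, -1} : Finset ℤ) → (2 * (n : ℂ) + 1) *
        (T n * jP q (2 * 0 + 1) * ju q ((0 : ℕ) - n) * ju q ((0 : ℕ) + 1 + n)) = 0 := by
      intro n hn
      rw [hz n hn, mul_zero]
    have hh := hasSum_sum_of_ne_finset_zero (s := {0, -1}) (L := SummationFilter.unconditional ℤ) hz2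
    have hv : ∑ n ∈ ({0, -1} : Finset ℤ), (2 * (n : ℂ) + 1) *
        (T n * jP q (2 * 0 + 1) * ju q ((0 : ℕ) - n) * ju q ((0 : ℕ) + 1 + n)) =
        2 * jP q 0 ^ 2 := by
      rw [Finset.sum_pair (by norm_num)]
      simp [hT0, hTm, ju, jP, h1q]
      field_simp
      ring
    rw [hv] at hh
    exact hh
  | succ N ih =>
    obtain ⟨s, h1, h2⟩ := ih
    set a : ℤ → ℂ := fun n => T n * jP q (2 * N + 1) * ju q (N - n) * ju q (N + 1 + n) with ha
    have h2 : HasSum (fun n : ℤ => (2 * (n : ℂ) + 1) * a n) (2 * jP q N ^ 2) := h2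
    have key : ∀ n : ℤ, T n * jP q (2 * (N + 1) + 1) * ju q ((N + 1 : ℕ) - n)
        * ju q ((N + 1 : ℕ) + 1 + n) =
        (1 + q ^ (2 * N + 2)) * a n - q ^ (N + 1) * a (n - 1) - q ^ (N + 1) * a (n + 1) := by
      intro n
      have e1 := ju_rec hq (N + 1 - n)
      have e2 := ju_rec hq (N - n)
      have e3 := ju_rec hq (N + 2 + n)
      have e4 := ju_rec hq (N + 1 + n)
      have t1 := hT n
      have t2 := hT (n - 1)
      rw [sub_add_cancel] at t2
      have hX : q ^ n ≠ 0 := zpow_ne_zero _ hq0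
      have t3 : T (n - 1) = - T n * (q ^ n)⁻¹ := by
        rw [t2]; field_simp
      have p1 : jP q (2 * (N + 1) + 1) = jP q (2 * N + 1) * (1 - q ^ (2 * N + 2)) * (1 - q ^ (2 * N + 3)) := by
        rw [show 2 * (N + 1) + 1 = 2 * N + 1 + 1 + 1 by ring]
        simp only [jP, Finset.prod_range_succ]
      rw [show (N + 1 - n - 1 : ℤ) = N - n by ring] at e1
      rw [show (N + 2 + n - 1 : ℤ) = N + 1 + n by ring] at e3
      rw [show (N + 1 + n - 1 : ℤ) = N + n by ring] at e4
      simp only [ha]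
      push_cast
      rw [show (N - (n - 1) : ℤ) = N + 1 - n by ring, show (N + 1 + (n - 1) : ℤ) = N + n by ring,
        show (N - (n + 1) : ℤ) = N - n - 1 by ring, show (N + 1 + (n + 1) : ℤ) = N + 2 + n by ring,
        show (N + 1 + 1 + n : ℤ) = N + 2 + n by ring, p1, t3, t1, e2, e4, e1, e3]
      simp only [zpow_add₀ hq0, zpow_sub₀ hq0, zpow_natCast, zpow_one, zpow_ofNat]
      generalize ju q (N + 1 - n) = u1
      generalize ju q (N + 2 + n) = u2
      have : q ^ (2 * N + 2) = q ^ N * q ^ N * q ^ 2 := by ring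
      rw [this]
      have : q ^ (2 * N + 3) = q ^ N * q ^ N * q ^ 3 := by ring
      rw [this, pow_succ q N]
      generalize q ^ N = Q at *
      generalize q ^ n = X at *
      field_simp
      ring
    clear_value a
    have s1 : HasSum (fun n => a (n - 1)) s := (Equiv.subRight (1 : ℤ)).hasSum_iff.mpr h1
    have s2 : HasSum (fun n => a (n + 1)) s := (Equiv.addRight (1 : ℤ)).hasSum_iff.mpr h1
    have d1 : HasSum (fun n : ℤ => (2 * ((n - 1 : ℤ) : ℂ) + 1) * a (n - 1)) (2 * jP q N ^ 2) :=
      (Equiv.subRight (1 : ℤ)).hasSum_iff.mpr h2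
    have d2 : HasSum (fun n : ℤ => (2 * ((n + 1 : ℤ) : ℂ) + 1) * a (n + 1)) (2 * jP q N ^ 2) :=
      (Equiv.addRight (1 : ℤ)).hasSum_iff.mpr h2
    have f1 := d1.add (s1.mul_left 2)
    have f2 := d2.sub (s2.mul_left 2)
    simp_rw [key]
    refine ⟨_, ((h1.mul_left _).sub (s1.mul_left _)).sub (s2.mul_left _), ?_⟩
    refine j_congr (((h2.mul_left (1 + q ^ (2 * N + 2))).sub (f1.mul_left (q ^ (N + 1)))).sub
      (f2.mul_left (q ^ (N + 1)))) ?_ ?_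
    · intro n
      push_cast
      ring
    · rw [show jP q (N + 1) = jP q N * (1 - q ^ (N + 1)) from Finset.prod_range_succ _ _]
      ring

lemma jP_tendsto {q : ℂ} (hq : ‖q‖ < 1) :
    Tendsto (jP q) atTop (nhds (∏' n : ℕ, (1 - q ^ (n + 1)))) :=
  (ModularForm.multipliable_one_sub_pow hq).hasProd.tendsto_prod_nat

lemma jP_lim_ne {q : ℂ} (hq : ‖q‖ < 1) : (∏' n : ℕ, (1 - q ^ (n + 1))) ≠ 0 := by
  have := tprod_one_add_ne_zero_of_summable (f := fun n : ℕ ↦ -q ^ (n + 1)) ?_ ?_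
  · simpa [sub_eq_add_neg] using this
  · intro i
    simpa [sub_eq_add_neg] using j_one_sub_ne hq i
  · simpa using (summable_nat_add_iff 1).mpr (summable_geometric_of_lt_one (norm_nonneg _) hq)

lemma j_limit {q : ℂ} (hq : ‖q‖ < 1) (hq0 : q ≠ 0) (T : ℤ → ℂ)
    (hT0 : T 0 = 1) (hT : ∀ n, T (n + 1) = - T n * q ^ (n + 1))
    (hs : Summable fun n : ℤ => (2 * n + 1) * T n) :
    ∑' n : ℤ, (2 * n + 1) * T n = 2 * (∏' n : ℕ, (1 - q ^ (n + 1))) ^ 3 := by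
  set L := ∏' n : ℕ, (1 - q ^ (n + 1)) with hL
  have hL0 : L ≠ 0 := jP_lim_ne hq
  have hP := jP_tendsto hq
  rw [← hL] at hP
  have hPi : Tendsto (fun n => (jP q n)⁻¹) atTop (nhds L⁻¹) := hP.inv₀ hL0
  obtain ⟨C, hC⟩ := (Metric.isBounded_range_of_tendsto _ hP).exists_norm_le
  obtain ⟨D, hD⟩ := (Metric.isBounded_range_of_tendsto _ hPi).exists_norm_le
  have hC' : ∀ n, ‖jP q n‖ ≤ C := fun n => hC _ ⟨n, rfl⟩
  have hD' : ∀ n, ‖(jP q n)⁻¹‖ ≤ D := fun n => hD _ ⟨n, rfl⟩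
  have hC0 : 0 ≤ C := (norm_nonneg _).trans (hC' 0)
  have hD0 : 0 ≤ D := (norm_nonneg _).trans (hD' 0)
  have hu : ∀ m, ‖ju q m‖ ≤ D := by
    intro m
    unfold ju
    split_ifs
    · simpa using hD0
    · exact hD' _
  have hut : Tendsto (ju q) atTop (nhds L⁻¹) := by
    have ht : Tendsto Int.toNat atTop atTop :=
      tendsto_atTop.mpr fun b => (eventually_ge_atTop (b : ℤ)).mono fun m hm => by omega
    refine (hPi.comp ht).congr' ?_
    filter_upwards [eventually_ge_atTop 0] with m hm
    simp [ju, not_lt.mpr hm]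
  have hlim := tendsto_tsum_of_dominated_convergence (𝓕 := atTop)
    (f := fun (N : ℕ) (n : ℤ) =>
      (2 * n + 1) * (T n * jP q (2 * N + 1) * ju q (N - n) * ju q (N + 1 + n)))
    (g := fun n : ℤ => (2 * n + 1) * (T n * L * L⁻¹ * L⁻¹))
    (bound := fun n : ℤ => ‖(2 * n + 1) * T n‖ * (C * D * D)) (hs.norm.mul_right _) ?_ ?_
  · have h1 : Tendsto (fun N => 2 * jP q N ^ 2) atTop (nhds (2 * L ^ 2)) :=
      (hP.pow 2).const_mul 2
    simp_rw [fun N => (j_sum hq hq0 T hT0 hT N).choose_spec.2.tsum_eq] at hlim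
    have h2 := tendsto_nhds_unique hlim h1
    have h3 : ∀ n : ℤ, (2 * n + 1) * (T n * L * L⁻¹ * L⁻¹) = ((2 * n + 1) * T n) * L⁻¹ := by
      intro n; field_simp
    simp_rw [h3, tsum_mul_right] at h2
    field_simp at h2
    rw [h2]
  · intro n
    have c1 : Tendsto (fun N : ℕ => 2 * N + 1) atTop atTop :=
      tendsto_atTop.mpr fun b => (eventually_ge_atTop b).mono fun m hm => by omega
    have c2 : Tendsto (fun N : ℕ => (N : ℤ) - n) atTop atTop :=
      tendsto_atTop.mpr fun b => (eventually_ge_atTop (b + n).toNat).mono fun m hm => by omega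
    have c3 : Tendsto (fun N : ℕ => (N : ℤ) + 1 + n) atTop atTop :=
      tendsto_atTop.mpr fun b => (eventually_ge_atTop (b - n).toNat).mono fun m hm => by omega
    exact ((((hP.comp c1).const_mul (T n)).mul (hut.comp c2)).mul (hut.comp c3)).const_mul _
  · refine Eventually.of_forall fun N n => ?_
    have : (2 * (n : ℂ) + 1) * (T n * jP q (2 * N + 1) * ju q (N - n) * ju q (N + 1 + n)) =
      ((2 * n + 1) * T n) * (jP q (2 * N + 1) * ju q (N - n) * ju q (N + 1 + n)) := by ring
    rw [this, norm_mul]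
    gcongr
    rw [norm_mul, norm_mul]
    gcongr
    · exact hC' _
    · exact hu _
    · exact hu _

lemma θ11_eq (z τ : ℂ) : θ11 z τ = Complex.exp ((Real.pi : ℂ) * I * τ / 4 + (Real.pi : ℂ) * I * z) *
    jacobiTheta₂ (z + (τ / 2 + 1 / 2)) τ := by
  unfold θ11 jacobiTheta₂
  rw [← tsum_mul_left]
  refine tsum_congr fun n => ?_
  rw [jacobiTheta₂_term, ← Complex.exp_pi_mul_I, ← Complex.exp_int_mul, ← Complex.exp_add,
    ← Complex.exp_add]
  congr 1
  ring

/-- Jacobi derivative formula: `∂θ11/∂z(0,τ) = 2πi·η(τ)³`. -/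
theorem jacobi_derivative_formula (τ : ℂ) (hτ : 0 < τ.im) :
    deriv (fun z : ℂ => θ11 z τ) 0 = 2 * (Real.pi : ℂ) * I * η τ ^ 3 := by
  set w : ℂ := τ / 2 + 1 / 2 with hw
  set q : ℂ := Complex.exp (2 * (Real.pi : ℂ) * I * τ) with hqd
  have hq : ‖q‖ < 1 := by
    simpa [hqd] using UpperHalfPlane.norm_exp_two_pi_I_lt_one ⟨τ, hτ⟩
  have hq0 : q ≠ 0 := Complex.exp_ne_zero _
  let T : ℤ → ℂ := fun n => jacobiTheta₂_term n w τ
  have hT0 : T 0 = 1 := by simp [T, jacobiTheta₂_term]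
  have hT : ∀ n, T (n + 1) = - T n * q ^ (n + 1) := by
    intro n
    simp only [T, jacobiTheta₂_term, hqd]
    rw [← Complex.exp_int_mul, neg_mul, ← Complex.exp_add, ← neg_one_mul,
      ← Complex.exp_pi_mul_I, ← Complex.exp_add]
    congr 1
    push_cast
    rw [hw]
    ring
  have g1 := hasSum_jacobiTheta₂_term w hτ
  have g2 := hasSum_jacobiTheta₂'_term w hτ
  have g3 := (g1.mul_left ((Real.pi : ℂ) * I)).add g2
  have g4 : HasSum (fun n : ℤ => (Real.pi * I : ℂ) * ((2 * n + 1) * T n))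
      (Real.pi * I * jacobiTheta₂ w τ + jacobiTheta₂' w τ) := by
    refine j_congr g3 (fun n => ?_) rfl
    simp only [T, jacobiTheta₂'_term]
    ring
  have hpi : (Real.pi * I : ℂ) ≠ 0 := by simp [Real.pi_ne_zero]
  have hs : Summable fun n : ℤ => (2 * n + 1) * T n := (summable_mul_left_iff hpi).mp g4.summable
  have g5 := g4.tsum_eq
  rw [tsum_mul_left, j_limit hq hq0 T hT0 hT hs] at g5
  have e1 : HasDerivAt (fun z : ℂ => Complex.exp ((Real.pi : ℂ) * I * τ / 4 + (Real.pi : ℂ) * I * z))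
      (Complex.exp ((Real.pi : ℂ) * I * τ / 4 + (Real.pi : ℂ) * I * 0) * ((Real.pi : ℂ) * I)) 0 := by
    have := (((hasDerivAt_id (0 : ℂ)).const_mul ((Real.pi : ℂ) * I)).const_add
      ((Real.pi : ℂ) * I * τ / 4)).cexp
    simpa using this
  have e2 : HasDerivAt (fun z : ℂ => jacobiTheta₂ (z + w) τ) (jacobiTheta₂' w τ) 0 := by
    have h := hasDerivAt_jacobiTheta₂_fst (0 + w) hτ
    simpa using h.comp_add_const 0 w
  have e3 := e1.mul e2
  have e4 : (fun z : ℂ => θ11 z τ) = fun z => Complex.exp ((Real.pi : ℂ) * I * τ / 4 +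
    (Real.pi : ℂ) * I * z) * jacobiTheta₂ (z + w) τ := by
    funext z
    exact θ11_eq z τ
  rw [e4]
  refine e3.deriv.trans ?_
  have e5 : Complex.exp ((Real.pi : ℂ) * I * τ / 12) ^ 3 = Complex.exp ((Real.pi : ℂ) * I * τ / 4) := by
    rw [← Complex.exp_nat_mul]
    congr 1
    push_cast
    ring
  rw [η, mul_pow, e5, ← hqd]
  simp only [mul_zero, add_zero, zero_add]
  linear_combination (-Complex.exp ((Real.pi : ℂ) * I * τ / 4)) * g5

end
end
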